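/- Let b be a positive integer with b ≡ 16518444216571 (mod 18446744073709551615). Then there exist infinitely many positive integers t such that the b-repunit (b^t − 1)/(b − 1) is a Riesel number. -/

import Mathlib

/-- A number is composite if it is a product of two integers greater than 1. -/
def IsComposite (n : ℕ) : Prop := ∃ a b : ℕ, 1 < a ∧ 1 < b ∧ n = a * b

/-- A Riesel number is an odd positive integer `k` such that `k·2^n − 1` is composite
for every positive integer `n`. -/
def IsRiesel (k : ℕ) : Prop := 0 < k ∧ Odd k ∧ ∀ n : ℕ, 0 < n → IsComposite (k * 2 ^ n - 1)

/-- Covering fact: a prime `p` with `p ∣ 2^m - 1` and `k * 2^c ≡ 1` divides `k * 2^n - 1`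
whenever `n ≡ c (mod m)`. -/
lemma composite_of_class (k p m c n : ℕ) (hp : 1 < p) (hk : p + 1 < k)
    (hm : 2 ^ m ≡ 1 [MOD p]) (hc : k * 2 ^ c ≡ 1 [MOD p]) (hn : n % m = c) :
    IsComposite (k * 2 ^ n - 1) := by
  have h1 : k * 2 ^ n ≡ 1 [MOD p] := by
    rw [← Nat.div_add_mod n m, hn, pow_add, pow_mul]
    calc k * ((2 ^ m) ^ (n / m) * 2 ^ c) ≡ k * (1 ^ (n / m) * 2 ^ c) [MOD p] :=
          ((hm.pow _).mul_right _).mul_left _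
      _ = k * 2 ^ c := by simp
      _ ≡ 1 [MOD p] := hc
  have hpos : 1 ≤ 2 ^ n := Nat.one_le_two_pow
  have hge : k ≤ k * 2 ^ n := Nat.le_mul_of_pos_right _ hpos
  have hd : p ∣ k * 2 ^ n - 1 := (Nat.modEq_iff_dvd' (by omega)).1 h1.symm
  obtain ⟨d, hd⟩ := hd
  refine ⟨p, d, hp, ?_, hd⟩
  by_contra hlt
  have : p * d ≤ p * 1 := Nat.mul_le_mul_left _ (by omega)
  omega

lemma geom_modEq (b t p : ℕ) (h : b ≡ 1 [MOD p]) :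
    ∑ i ∈ Finset.range t, b ^ i ≡ t [MOD p] := by
  induction t with
  | zero => simp; rfl
  | succ t ih =>
    rw [Finset.sum_range_succ]
    simpa using ih.add (h.pow t)

lemma covering (n : ℕ) : n % 2 = 1 ∨ n % 4 = 2 ∨ n % 8 = 4 ∨ n % 16 = 8 ∨ n % 32 = 16 ∨
    n % 64 = 32 ∨ n % 64 = 0 := by
  omega

lemma pow_step (x y z e d f p : ℕ) (hf : f = e * 16 + d) (h : x ^ e ≡ y [MOD p]) (h2 : y ^ 16 * x ^ d ≡ z [MOD p]) :
    x ^ f ≡ z [MOD p] := by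
  rw [hf, pow_add, pow_mul]
  exact ((h.pow 16).mul_right _).trans h2

lemma pow_ord : 16518444216571 ^ 2233472 ≡ 1 [MOD 6700417] := by
  have h0 : 16518444216571 ≡ 6692726 [MOD 6700417] := by decide
  have h1 : 6692726 ^ 2 ≡ 5548145 [MOD 6700417] := by decide
  have h2 : 6692726 ^ 34 ≡ 1960003 [MOD 6700417] :=
    pow_step 6692726 5548145 1960003 2 2 34 6700417 (by norm_num) h1 (by decide)
  have h3 : 6692726 ^ 545 ≡ 3255750 [MOD 6700417] :=
    pow_step 6692726 1960003 3255750 34 1 545 6700417 (by norm_num) h2 (by decide)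
  have h4 : 6692726 ^ 8724 ≡ 5792428 [MOD 6700417] :=
    pow_step 6692726 3255750 5792428 545 4 8724 6700417 (by norm_num) h3 (by decide)
  have h5 : 6692726 ^ 139592 ≡ 6281641 [MOD 6700417] :=
    pow_step 6692726 5792428 6281641 8724 8 139592 6700417 (by norm_num) h4 (by decide)
  have h6 : 6692726 ^ 2233472 ≡ 1 [MOD 6700417] :=
    pow_step 6692726 6281641 1 139592 0 2233472 6700417 (by norm_num) h5 (by decide)
  exact (h0.pow _).trans h6

/-- Let `b` be a positive integer with
`b ≡ 16518444216571 (mod 18446744073709551615)`.  Then there exist infinitely many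
positive integers `t` such that the `b`-repunit `(b^t − 1)/(b − 1)` is a Riesel number. -/
theorem stmt_15 (b : ℕ) (hb : 0 < b)
    (hmod : b ≡ 16518444216571 [MOD 18446744073709551615]) :
    {t : ℕ | 0 < t ∧ IsRiesel ((b ^ t - 1) / (b - 1))}.Infinite := by
  have hbig : 16518444216571 ≤ b := by
    unfold Nat.ModEq at hmod
    omega
  apply Set.infinite_of_injective_forall_mem
    (f := fun m : ℕ => 5566401850543975169 + 6148913773545171840 * m)
  · intro x y h
    simp only at h
    omega
  intro m
  obtain ⟨t, ht⟩ : ∃ t, t = 5566401850543975169 + 6148913773545171840 * m := ⟨_, rfl⟩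
  simp only [← ht]
  refine ⟨by omega, ?_⟩
  rw [← Nat.geomSum_eq (by omega : 2 ≤ b)]
  have hmodp : ∀ p r, p ∣ 18446744073709551615 → 16518444216571 ≡ 1 [MOD p] →
      p ∣ 6148913773545171840 → 5566401850543975169 ≡ r [MOD p] →
      ∑ i ∈ Finset.range t, b ^ i ≡ r [MOD p] := by
    intro p r hp h hL hr
    refine (geom_modEq b t p ((hmod.of_dvd hp).trans h)).trans ?_
    rw [ht]
    have h0 : 6148913773545171840 * m ≡ 0 [MOD p] :=
      (Nat.modEq_zero_iff_dvd).2 (hL.mul_right m)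
    simpa using hr.add h0
  have hk3 := hmodp 3 2 (by norm_num) (by decide) (by norm_num) (by decide)
  have hk5 := hmodp 5 4 (by norm_num) (by decide) (by norm_num) (by decide)
  have hk17 := hmodp 17 16 (by norm_num) (by decide) (by norm_num) (by decide)
  have hk257 := hmodp 257 256 (by norm_num) (by decide) (by norm_num) (by decide)
  have hk641 := hmodp 641 640 (by norm_num) (by decide) (by norm_num) (by decide)
  have hk65537 := hmodp 65537 65536 (by norm_num) (by decide) (by norm_num) (by decide)
  have hkq : ∑ i ∈ Finset.range t, b ^ i ≡ 1 [MOD 6700417] := by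
    have hbq : b ≡ 16518444216571 [MOD 6700417] := hmod.of_dvd (by norm_num)
    have hord : b ^ 2233472 ≡ 1 [MOD 6700417] := (hbq.pow _).trans pow_ord
    obtain ⟨s, hs⟩ : ∃ s, t = 2233472 * s + 1 := ⟨t / 2233472, by omega⟩
    have hbt : b ^ t ≡ b [MOD 6700417] := by
      rw [hs, pow_succ, pow_mul]
      simpa using (hord.pow s).mul_right b
    have hg : (b - 1) * ∑ i ∈ Finset.range t, b ^ i + 1 = b ^ t := by
      have := Nat.geomSum_eq (by omega : 2 ≤ b) t
      have h2 := Nat.sub_one_dvd_pow_sub_one b t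
      rw [this, Nat.mul_div_cancel' h2]
      exact Nat.sub_add_cancel (Nat.one_le_pow _ _ hb)
    have h3 : (b - 1) * ∑ i ∈ Finset.range t, b ^ i + 1 ≡ (b - 1) * 1 + 1 [MOD 6700417] := by
      rw [hg, mul_one, Nat.sub_add_cancel hb]
      exact hbt
    have h4 := Nat.ModEq.add_right_cancel' 1 h3
    refine Nat.ModEq.cancel_left_of_coprime ?_ h4
    have h5 : (b - 1) % 6700417 = 6692725 := by
      unfold Nat.ModEq at hbq
      omega
    rw [Nat.gcd_rec, h5]
    norm_num
  have hlarge : b + 1 ≤ ∑ i ∈ Finset.range t, b ^ i := by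
    calc b + 1 = ∑ i ∈ Finset.range 2, b ^ i := by simp [Finset.sum_range_succ]; omega
      _ ≤ _ := Finset.sum_le_sum_of_subset (Finset.range_mono (by omega))
  have hodd : Odd (∑ i ∈ Finset.range t, b ^ i) := by
    rcases Nat.even_or_odd b with he | ho
    · obtain ⟨s, hs⟩ : ∃ s, t = s + 1 := ⟨t - 1, by omega⟩
      rw [hs, Finset.sum_range_succ']
      simp only [pow_zero]
      refine Even.add_one (Finset.even_sum _ fun i _ => ?_)
      rw [pow_succ]
      exact he.mul_left _
    · have h2 := geom_modEq b t 2 (by rw [Nat.odd_iff] at ho; exact ho)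
      rw [Nat.odd_iff]
      unfold Nat.ModEq at h2
      omega
  generalize ∑ i ∈ Finset.range t, b ^ i = k at *
  have hk : 6700418 < k := by omega
  refine ⟨by omega, hodd, fun n _ => ?_⟩
  rcases covering n with h | h | h | h | h | h | h
  · exact composite_of_class k 3 2 1 n (by norm_num) (lt_of_le_of_lt (by norm_num) hk)
      (by decide) ((hk3.mul_right _).trans (by decide)) h
  · exact composite_of_class k 5 4 2 n (by norm_num) (lt_of_le_of_lt (by norm_num) hk)
      (by decide) ((hk5.mul_right _).trans (by decide)) h
  · exact composite_of_class k 17 8 4 n (by norm_num) (lt_of_le_of_lt (by norm_num) hk)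
      (by decide) ((hk17.mul_right _).trans (by decide)) h
  · exact composite_of_class k 257 16 8 n (by norm_num) (lt_of_le_of_lt (by norm_num) hk)
      (by decide) ((hk257.mul_right _).trans (by decide)) h
  · exact composite_of_class k 65537 32 16 n (by norm_num) (lt_of_le_of_lt (by norm_num) hk)
      (by decide) ((hk65537.mul_right _).trans (by decide)) h
  · exact composite_of_class k 641 64 32 n (by norm_num) (lt_of_le_of_lt (by norm_num) hk)
      (by decide) ((hk641.mul_right _).trans (by decide)) h
  · exact composite_of_class k 6700417 64 0 n (by norm_num) (lt_of_le_of_lt (by norm_num) hk)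
      (by decide) ((hkq.mul_right _).trans (by decide)) h
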